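/- Let p be a prime and U ⊆ F_p^2 a set with #U = n·p - r, where n and r are integers with 1 ≤ n ≤ p and 0 ≤ r < p. If U is not contained in the union of n lines of F_p^2, then the number of U-special directions is at least ⌈(p + n + 2 - r)/(n + 1)⌉. -/

import Mathlib

open Finset Polynomial

attribute [local instance] Classical.propDecidable

/-- The line in `(ZMod p)²` with slope `m` (where `none` denotes the vertical
slope `∞`) and "intercept" `c`. -/
noncomputable def lineWithSlope (p : ℕ) [NeZero p] (m : Option (ZMod p)) (c : ZMod p) :
    Finset (ZMod p × ZMod p) :=
  match m with
  | some m => Finset.univ.filter fun q => q.2 = m * q.1 + c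
  | none => Finset.univ.filter fun q => q.1 = c

/-- `ℓ` is `U`-rich: it meets `U` in at least `#U/p + 1` points. -/
def IsRich (p : ℕ) (U ℓ : Finset (ZMod p × ZMod p)) : Prop :=
  (U.card : ℚ) / p + 1 ≤ ((ℓ ∩ U).card : ℚ)

/-- `ℓ` is `U`-poor: it meets `U` in at most `#U/p - 1` points. -/
def IsPoor (p : ℕ) (U ℓ : Finset (ZMod p × ZMod p)) : Prop :=
  ((ℓ ∩ U).card : ℚ) ≤ (U.card : ℚ) / p - 1

/-- `m` is a `U`-rich direction: some line with slope `m` is `U`-rich. -/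
def IsRichDir (p : ℕ) [NeZero p] (U : Finset (ZMod p × ZMod p))
    (m : Option (ZMod p)) : Prop :=
  ∃ c : ZMod p, IsRich p U (lineWithSlope p m c)

/-- `m` is a `U`-special direction: some line with slope `m` is `U`-rich or `U`-poor. -/
def IsSpecialDir (p : ℕ) [NeZero p] (U : Finset (ZMod p × ZMod p))
    (m : Option (ZMod p)) : Prop :=
  ∃ c : ZMod p, IsRich p U (lineWithSlope p m c) ∨ IsPoor p U (lineWithSlope p m c)

/-- A bivariate polynomial, seen as a polynomial in `X` over `R[Y]`, has total degree at most `d`. -/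
def TotalDegLE {R : Type*} [CommRing R] (d : ℕ) (P : R[X][X]) : Prop :=
  ∀ t s, d < t + s → (P.coeff t).coeff s = 0

namespace TotalDegLE

variable {R : Type*} [CommRing R] {d e : ℕ} {P Q : R[X][X]}

theorem add (hP : TotalDegLE d P) (hQ : TotalDegLE d Q) : TotalDegLE d (P + Q) := by
  intro t s h
  simp [hP t s h, hQ t s h]

theorem sub (hP : TotalDegLE d P) (hQ : TotalDegLE d Q) : TotalDegLE d (P - Q) := by
  intro t s h
  simp [hP t s h, hQ t s h]

theorem mul (hP : TotalDegLE d P) (hQ : TotalDegLE e Q) : TotalDegLE (d + e) (P * Q) := by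
  intro t s h
  rw [coeff_mul, finsetSum_coeff]
  refine Finset.sum_eq_zero fun x hx => ?_
  rw [coeff_mul]
  refine Finset.sum_eq_zero fun y hy => ?_
  rw [HasAntidiagonal.mem_antidiagonal] at hx hy
  by_cases hd : d < x.1 + y.1
  · rw [hP _ _ hd, zero_mul]
  · rw [hQ _ _ (by omega), mul_zero]

theorem one : TotalDegLE 0 (1 : R[X][X]) := by
  intro t s h
  rw [coeff_one]
  split_ifs with ht
  · rw [coeff_one, if_neg (by omega)]
  · simp

theorem pow (hP : TotalDegLE d P) (n : ℕ) : TotalDegLE (n * d) (P ^ n) := by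
  induction n with
  | zero => simpa using one
  | succ n ih => rw [pow_succ, Nat.succ_mul]; exact ih.mul hP

theorem prod {ι : Type*} (s : Finset ι) (f : ι → R[X][X]) (hf : ∀ i ∈ s, TotalDegLE 1 (f i)) :
    TotalDegLE #s (∏ i ∈ s, f i) := by
  induction s using Finset.induction_on with
  | empty => simpa using one
  | insert i s hi ih =>
    rw [prod_insert hi, card_insert_of_notMem hi, add_comm]
    exact (hf i (mem_insert_self i s)).mul (ih fun j hj => hf j (mem_insert_of_mem hj))

theorem X_add_C_linear (a b : R) : TotalDegLE 1 (X + C (C a * X - C b) : R[X][X]) := by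
  intro t s h
  rw [coeff_add, coeff_X, coeff_C, coeff_add]
  have h1 : (if 1 = t then (1 : R[X]) else 0).coeff s = 0 := by
    split_ifs with ht
    · rw [coeff_one, if_neg (by omega)]
    · simp
  have h2 : (if t = 0 then C a * X - C b else (0 : R[X])).coeff s = 0 := by
    split_ifs with ht
    · have h1s : ¬ 1 = s := by omega
      have h0s : ¬ s = 0 := by omega
      simp [coeff_X, coeff_C, h1s, h0s]
    · simp
  rw [h1, h2, add_zero]

theorem exists_quotient [Nontrivial R] {D : R[X][X]} (hD : D.Monic) (hDe : TotalDegLE D.natDegree D)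
    (P : R[X][X]) (hP : TotalDegLE (D.natDegree + d) P) :
    ∃ Q S, S + D * Q = P ∧ S.degree < D.degree ∧ TotalDegLE d Q ∧
      TotalDegLE (D.natDegree + d) S := by
  by_cases hlt : P.degree < D.degree
  · exact ⟨0, P, by simp, hlt, fun t s _ => by simp, hP⟩
  push Not at hlt
  by_cases hP0 : P = 0
  · exact ⟨0, 0, by simp [hP0], by simpa [bot_lt_iff_ne_bot] using hD.ne_zero,
      fun t s _ => by simp, fun t s _ => by simp⟩
  have hdeg := div_wf_lemma ⟨hlt, hP0⟩ hD
  have hnat : D.natDegree ≤ P.natDegree := natDegree_le_natDegree hlt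
  set T : R[X][X] := C P.leadingCoeff * X ^ (P.natDegree - D.natDegree) with hT
  have hTd : TotalDegLE d T := by
    intro t s h
    rw [hT, coeff_C_mul, coeff_X_pow]
    split_ifs with ht
    · rw [mul_one]
      exact hP _ _ (by omega)
    · simp
  obtain ⟨Q, S, h1, h2, h3, h4⟩ := exists_quotient hD hDe (P - D * T) (hP.sub (hDe.mul hTd))
  exact ⟨Q + T, S, by rw [mul_add, ← add_assoc, h1]; ring, h2, h3.add hTd, h4⟩
termination_by P.degree

theorem divByMonic [Nontrivial R] {D : R[X][X]} (hD : D.Monic) (hDe : TotalDegLE D.natDegree D)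
    (hP : TotalDegLE (D.natDegree + d) P) : TotalDegLE d (P /ₘ D) := by
  obtain ⟨Q, S, h1, h2, h3, -⟩ := exists_quotient hD hDe P hP
  rwa [(div_modByMonic_unique Q S hD ⟨h1, h2⟩).1]

theorem modByMonic [Nontrivial R] {D : R[X][X]} (hD : D.Monic) (hDe : TotalDegLE D.natDegree D)
    (hP : TotalDegLE (D.natDegree + d) P) : TotalDegLE (D.natDegree + d) (P %ₘ D) := by
  obtain ⟨Q, S, h1, h2, -, h4⟩ := exists_quotient hD hDe P hP
  rwa [(div_modByMonic_unique Q S hD ⟨h1, h2⟩).2]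

/-- Substituting a polynomial of degree at most one for `X`. -/
theorem natDegree_eval_le (hP : TotalDegLE d P) {q : R[X]} (hq : q.natDegree ≤ 1) :
    (P.eval q).natDegree ≤ d := by
  rw [eval_eq_sum, Polynomial.sum]
  refine natDegree_sum_le_of_forall_le _ _ fun t ht => ?_
  have htd : t ≤ d := by
    by_contra! h
    refine mem_support_iff.1 ht (Polynomial.ext fun s => ?_)
    rw [hP t s (by omega), coeff_zero]
  have h1 : (P.coeff t).natDegree ≤ d - t :=
    natDegree_le_iff_coeff_eq_zero.2 fun s hs => hP t s (by omega)
  have h2 : (q ^ t).natDegree ≤ t := natDegree_pow_le.trans (by nlinarith)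
  exact natDegree_mul_le.trans (by omega)

end TotalDegLE

section Digits

variable {R : Type*} [CommRing R]

/-- The digit at position `l` in the expansion of `P` to base `W`. -/
noncomputable def adicDigit (W : R[X]) (l : ℕ) (P : R[X]) : R[X] :=
  ((· /ₘ W)^[l] P) %ₘ W

theorem adicDigit_succ (W : R[X]) (l : ℕ) (P : R[X]) :
    adicDigit W (l + 1) P = adicDigit W l (P /ₘ W) := rfl

theorem add_divByMonic' {W : R[X]} (hW : W.Monic) (P Q : R[X]) :
    (P + Q) /ₘ W = P /ₘ W + Q /ₘ W := by
  nontriviality R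
  refine (div_modByMonic_unique _ (P %ₘ W + Q %ₘ W) hW ⟨?_, ?_⟩).1
  · linear_combination modByMonic_add_div P W + modByMonic_add_div Q W
  · exact (degree_add_le _ _).trans_lt
      (max_lt (degree_modByMonic_lt P hW) (degree_modByMonic_lt Q hW))

theorem C_mul_div_modByMonic {W : R[X]} (hW : W.Monic) (z : R) (P : R[X]) :
    (C z * P) /ₘ W = C z * (P /ₘ W) ∧ (C z * P) %ₘ W = C z * (P %ₘ W) := by
  nontriviality R
  refine div_modByMonic_unique _ _ hW ⟨?_, ?_⟩
  · linear_combination C z * modByMonic_add_div P W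
  · rw [← smul_eq_C_mul]
    exact (degree_smul_le _ _).trans_lt (degree_modByMonic_lt P hW)

theorem adicDigit_add {W : R[X]} (hW : W.Monic) (l : ℕ) (P Q : R[X]) :
    adicDigit W l (P + Q) = adicDigit W l P + adicDigit W l Q := by
  induction l generalizing P Q with
  | zero => exact add_modByMonic P Q
  | succ l ih => rw [adicDigit_succ, add_divByMonic' hW, ih]; rfl

theorem adicDigit_C_mul {W : R[X]} (hW : W.Monic) (z : R) (l : ℕ) (P : R[X]) :
    adicDigit W l (C z * P) = C z * adicDigit W l P := by
  induction l generalizing P with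
  | zero => exact (C_mul_div_modByMonic hW z P).2
  | succ l ih => rw [adicDigit_succ, (C_mul_div_modByMonic hW z P).1, ih]; rfl

theorem pow_dvd_adicDigit {W : R[X]} (hW : W.Monic) (z : R) (n : ℕ) {P : R[X]}
    (hP : P ∈ Ideal.span {W, C z} ^ n) (l : ℕ) : C (z ^ (n - l)) ∣ adicDigit W l P := by
  induction n generalizing P l with
  | zero => simp
  | succ n ih =>
    rw [pow_succ] at hP
    induction hP using Submodule.mul_induction_on' with
    | mem_mul_mem g hg h hh =>
      obtain ⟨a, b, rfl⟩ := Ideal.mem_span_pair.1 hh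
      rw [show g * (a * W + b * C z) = W * (g * a) + C z * (g * b) by ring, adicDigit_add hW,
        adicDigit_C_mul hW]
      refine dvd_add ?_ ?_
      · cases l with
        | zero =>
          have : adicDigit W 0 (W * (g * a)) = 0 :=
            (modByMonic_eq_zero_iff_dvd hW).2 (dvd_mul_right _ _)
          rw [this]
          exact dvd_zero _
        | succ l =>
          rw [adicDigit_succ, mul_divByMonic_cancel_left _ hW, Nat.add_sub_add_right]
          exact ih (Ideal.mul_mem_right _ _ hg) l
      · rcases le_or_gt l n with hl | hl
        · rw [Nat.sub_add_comm hl, pow_succ', C_mul]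
          exact mul_dvd_mul_left _ (ih (Ideal.mul_mem_right _ _ hg) l)
        · simp [Nat.sub_eq_zero_of_le hl]
    | add P _ Q _ hP hQ =>
      rw [adicDigit_add hW]
      exact dvd_add hP hQ

theorem eq_sum_adicDigit (W P : R[X]) (n : ℕ) :
    P = ∑ l ∈ range n, W ^ l * adicDigit W l P + W ^ n * (· /ₘ W)^[n] P := by
  induction n with
  | zero => simp
  | succ n ih =>
    conv_lhs => rw [ih]
    rw [sum_range_succ, Function.iterate_succ_apply', add_assoc]
    congr 1
    have := modByMonic_add_div ((· /ₘ W)^[n] P) W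
    rw [adicDigit, pow_succ]
    linear_combination (- W ^ n) * this

theorem TotalDegLE.iterate_divByMonic [Nontrivial R] {W : R[X][X]} (hW : W.Monic)
    (hWd : TotalDegLE W.natDegree W) {n l : ℕ} (hl : l ≤ n) {P : R[X][X]}
    (hP : TotalDegLE (n * W.natDegree) P) :
    TotalDegLE ((n - l) * W.natDegree) ((· /ₘ W)^[l] P) := by
  induction l with
  | zero => simpa using hP
  | succ l ih =>
    rw [Function.iterate_succ_apply']
    refine TotalDegLE.divByMonic hW hWd ?_
    convert ih (by omega) using 1
    rw [show n - l = (n - (l + 1)) + 1 by omega]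
    ring

theorem TotalDegLE.adicDigit [Nontrivial R] {W : R[X][X]} (hW : W.Monic)
    (hWd : TotalDegLE W.natDegree W) {n l : ℕ} (hl : l < n) {P : R[X][X]}
    (hP : TotalDegLE (n * W.natDegree) P) :
    TotalDegLE ((n - l) * W.natDegree) (adicDigit W l P) := by
  have h := TotalDegLE.iterate_divByMonic hW hWd hl.le hP
  rw [show (n - l) * W.natDegree = W.natDegree + (n - l - 1) * W.natDegree by
    obtain ⟨k, hk⟩ : ∃ k, n - l = k + 1 := ⟨n - l - 1, by omega⟩
    rw [hk]; simp; ring] at h ⊢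
  exact TotalDegLE.modByMonic hW hWd h

end Digits

section PrimeField

variable {p : ℕ} [Fact p.Prime]

theorem prod_X_sub_C_zmod : ∏ c : ZMod p, (X - C c) = (X ^ p - X : (ZMod p)[X]) := by
  have hp : 1 < p := (Fact.out : p.Prime).one_lt
  have hroots := FiniteField.roots_X_pow_card_sub_X (ZMod p)
  rw [ZMod.card] at hroots
  have hdeg := FiniteField.X_pow_card_sub_X_natDegree_eq (ZMod p) hp
  have h := prod_multiset_X_sub_C_of_monic_of_roots_card_eq (p := (X ^ p - X : (ZMod p)[X]))
    (monic_X_pow_sub (by rw [degree_X]; exact_mod_cast hp))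
    (by rw [hroots, hdeg]; simp [ZMod.card])
  rw [hroots] at h
  exact h

theorem sum_le_sum_sub_add {ι : Type*} (s : Finset ι) (k : ι → ℕ) (j : ℕ) :
    ∑ c ∈ s, k c ≤ ∑ c ∈ s, (k c - j) + #s * j := by
  rw [← smul_eq_mul, ← sum_const, ← sum_add_distrib]
  exact sum_le_sum fun c _ => by omega

theorem exists_large_of_derivative_eq_zero {n r T : ℕ} (k : ZMod p → ℕ) {G : (ZMod p)[X]}
    (hG0 : G ≠ 0) (hG' : derivative G = 0) (hn : 1 ≤ n) (hdeg : G.natDegree ≤ n * p)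
    (hroot : ∀ c, 0 < k c → G.eval c = 0) (hsum : n * p ≤ ∑ c, k c + r) (hT : r + T < p) :
    ∃ c, T < k c := by
  have hp : p.Prime := Fact.out
  set A := contract p G with hA
  have hGA : expand (ZMod p) p A = G := expand_contract p hG' hp.ne_zero
  have hA0 : A ≠ 0 := by
    rintro h
    rw [h, map_zero] at hGA
    exact hG0 hGA.symm
  have hAdeg : A.natDegree ≤ n := by
    rw [← hGA, natDegree_expand] at hdeg
    exact Nat.le_of_mul_le_mul_right hdeg hp.pos
  set S := univ.filter fun c => 0 < k c with hS
  have hScard : #S ≤ n := by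
    refine (card_le_degree_of_subset_roots fun c hc => ?_).trans hAdeg
    rw [mem_roots hA0, IsRoot.def]
    have := hroot c (by simpa [hS] using hc)
    rwa [← hGA, expand_eval, ZMod.pow_card] at this
  by_contra! hcon
  have h1 : ∑ c, k c = ∑ c ∈ S, k c := by
    refine (sum_subset (subset_univ _) fun c _ hc => ?_).symm
    simpa [hS] using hc
  have h2 : ∑ c ∈ S, k c ≤ #S * T := by
    rw [← smul_eq_mul]
    exact sum_le_card_nsmul _ _ _ fun c _ => hcon c
  nlinarith

theorem X_sub_C_pow_dvd_of_dvd_mul {k j : ℕ} {c : ZMod p} {G : (ZMod p)[X]}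
    (h : (X - C c) ^ k ∣ (X ^ p - X) ^ j * G) : (X - C c) ^ (k - j) ∣ G := by
  rcases le_total k j with hkj | hkj
  · simp [Nat.sub_eq_zero_of_le hkj]
  rw [← prod_X_sub_C_zmod, ← mul_prod_erase univ _ (mem_univ c), mul_pow, mul_assoc] at h
  nth_rw 1 [← Nat.add_sub_cancel' hkj] at h
  rw [pow_add] at h
  have h2 := (mul_dvd_mul_iff_left (pow_ne_zero j (X_sub_C_ne_zero c))).1 h
  refine IsCoprime.dvd_of_dvd_mul_left (IsCoprime.pow (IsCoprime.prod_right fun d hd => ?_)) h2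
  exact pairwise_coprime_X_sub_C Function.injective_id (ne_of_mem_erase hd).symm

theorem natDegree_derivative_sum_le {m N : ℕ} (q : ℕ → (ZMod p)[X]) (hm : 1 ≤ m) (hN : N < p)
    (hq : ∀ i ≤ m, (q i).natDegree ≤ (m - i) * (p - N)) :
    (derivative (∑ i ∈ range (m + 1), (X ^ p - X) ^ i * q i)).natDegree ≤ m * p - N - 1 := by
  have hp : p.Prime := Fact.out
  have hWdeg : (X ^ p - X : (ZMod p)[X]).natDegree = p :=
    FiniteField.X_pow_card_sub_X_natDegree_eq (ZMod p) hp.one_lt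
  have hW' : derivative (X ^ p - X : (ZMod p)[X]) = -1 := by
    simp [derivative_X_pow]
  have hWpow : ∀ i, ((X ^ p - X : (ZMod p)[X]) ^ i).natDegree ≤ i * p := fun i => by
    rw [natDegree_pow, hWdeg]
  have hmp : p ≤ m * p := Nat.le_mul_of_pos_left p hm
  rw [sum_range_succ, derivative_add]
  refine natDegree_add_le_of_degree_le ?_ ?_
  · refine (natDegree_derivative_le _).trans (Nat.sub_le_sub_right ?_ 1)
    refine natDegree_sum_le_of_forall_le _ _ fun i hi => natDegree_mul_le.trans ?_
    have him : i < m := mem_range.1 hi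
    refine (add_le_add (hWpow i) (hq i him.le)).trans ?_
    obtain ⟨s, rfl⟩ : ∃ s, m = i + 1 + s := ⟨m - i - 1, by omega⟩
    obtain ⟨t, rfl⟩ : ∃ t, p = N + t := ⟨p - N, by omega⟩
    rw [show i + 1 + s - i = s + 1 by omega, Nat.add_sub_cancel_left]
    refine Nat.le_sub_of_add_le ?_
    nlinarith [Nat.zero_le (s * N)]
  · have hconst := hq m le_rfl
    rw [Nat.sub_self, zero_mul, Nat.le_zero] at hconst
    rw [eq_C_of_natDegree_eq_zero hconst, mul_comm, derivative_C_mul, derivative_pow, hW']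
    refine (natDegree_C_mul_le _ _).trans ?_
    rw [mul_neg_one, natDegree_neg]
    refine (natDegree_C_mul_le _ _).trans ((hWpow _).trans ?_)
    obtain ⟨s, rfl⟩ : ∃ s, m = s + 1 := ⟨m - 1, by omega⟩
    rw [Nat.add_sub_cancel, Nat.succ_mul]
    omega

theorem exists_large_multiplicity {n r N : ℕ} (k : ZMod p → ℕ) {H : (ZMod p)[X]}
    (q : ℕ → (ZMod p)[X]) (hH0 : H ≠ 0)
    (hH : H = ∑ l ∈ range (n + 1), (X ^ p - X) ^ l * q l)
    (hq : ∀ l ≤ n, (q l).natDegree ≤ (n - l) * (p - N))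
    (hsum : ∑ c, k c + r = n * p) (hk : ∀ c, (X - C c) ^ k c ∣ H) (hrich : ∃ c, n < k c)
    (hN : N < p) (hNr : n * p + r ≤ (n + 1) * N) : ∃ c, n * (p - N) < k c := by
  have hp : p.Prime := Fact.out
  have hex : ∃ l, l ≤ n ∧ q l ≠ 0 := by
    by_contra! hcon
    refine hH0 (hH.trans (sum_eq_zero fun l hl => ?_))
    rw [hcon l (Nat.lt_succ_iff.1 (mem_range.1 hl)), mul_zero]
  obtain ⟨j, ⟨hjn, hqj⟩, hmin⟩ : ∃ j, (j ≤ n ∧ q j ≠ 0) ∧ ∀ l < j, ¬ (l ≤ n ∧ q l ≠ 0) :=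
    ⟨Nat.find hex, Nat.find_spec hex, fun l hl => Nat.find_min hex hl⟩
  obtain ⟨m, rfl⟩ := Nat.exists_eq_add_of_le hjn
  set G := ∑ i ∈ range (m + 1), (X ^ p - X) ^ i * q (j + i) with hG
  have hHG : H = (X ^ p - X) ^ j * G := by
    rw [hH, add_assoc, sum_range_add, sum_eq_zero, zero_add, hG, mul_sum]
    · exact sum_congr rfl fun i _ => by rw [pow_add, mul_assoc]
    · intro l hl
      have hl := mem_range.1 hl
      rw [show q l = 0 from by_contra fun h => hmin l hl ⟨by omega, h⟩, mul_zero]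
  have hG0 : G ≠ 0 := by
    rintro h
    rw [h, mul_zero] at hHG
    exact hH0 hHG
  have hkG : ∀ c, (X - C c) ^ (k c - j) ∣ G := fun c =>
    X_sub_C_pow_dvd_of_dvd_mul (hHG ▸ hk c)
  have hqm : ∀ i ≤ m, (q (j + i)).natDegree ≤ (m - i) * (p - N) := fun i hi => by
    have := hq (j + i) (by omega)
    rwa [Nat.add_sub_add_left] at this
  have hroot : ∀ c, 0 < k c - j → G.eval c = 0 := fun c hc =>
    dvd_iff_isRoot.1 ((dvd_pow_self _ hc.ne').trans (hkG c))
  have hm : 1 ≤ m := by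
    by_contra! hm0
    obtain rfl : m = 0 := by omega
    obtain ⟨c, hc⟩ := hrich
    have hdeg := hqm 0 le_rfl
    rw [Nat.sub_self, zero_mul, Nat.le_zero] at hdeg
    have h0 := hroot c (by omega)
    rw [hG, zero_add, sum_range_one, pow_zero, one_mul, eq_C_of_natDegree_eq_zero hdeg, eval_C] at h0
    exact hqj (by rw [← Nat.add_zero j, eq_C_of_natDegree_eq_zero hdeg, h0, C_0])
  have hsum' : m * p ≤ ∑ c, (k c - j) + r := by
    have := sum_le_sum_sub_add univ k j
    rw [card_univ, ZMod.card] at this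
    nlinarith
  have hWdeg : (X ^ p - X : (ZMod p)[X]).natDegree = p :=
    FiniteField.X_pow_card_sub_X_natDegree_eq (ZMod p) hp.one_lt
  obtain ⟨t, ht⟩ : ∃ t, p = N + t := ⟨p - N, by omega⟩
  have ht' : p - N = t := by omega
  by_cases hG' : derivative G = 0
  · obtain ⟨c, hc⟩ := exists_large_of_derivative_eq_zero (n := m) (r := r) (T := (j + m) * (p - N))
      (fun c => k c - j) hG0 hG' hm (by
        refine natDegree_sum_le_of_forall_le _ _ fun i hi => natDegree_mul_le.trans ?_
        have him : i ≤ m := Nat.lt_succ_iff.1 (mem_range.1 hi)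
        rw [natDegree_pow, hWdeg]
        refine (add_le_add_right (hqm i him) _).trans ?_
        obtain ⟨s, rfl⟩ := Nat.exists_eq_add_of_le him
        rw [Nat.add_sub_cancel_left, add_mul]
        exact add_le_add_right (Nat.mul_le_mul_left _ (Nat.sub_le _ _)) _)
      hroot hsum' (by rw [ht']; nlinarith)
    exact ⟨c, by omega⟩
  · exfalso
    have hdvd : ∏ c, (X - C c) ^ (k c - j) ∣ q j * derivative G := by
      refine Finset.prod_dvd_of_coprime (fun c _ d _ hcd => ?_) fun c _ => ?_
      · exact (pairwise_coprime_X_sub_C Function.injective_id hcd).pow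
      · rcases Nat.eq_zero_or_pos (k c - j) with h0 | hpos
        · simp [h0]
        · rw [← Nat.sub_add_cancel hpos, pow_succ']
          refine mul_dvd_mul (dvd_iff_isRoot.2 ?_) ?_
          · have := hroot c hpos
            rw [hG, sum_range_succ', eval_add, eval_finsetSum] at this
            simpa [ZMod.pow_card] using this
          · exact pow_sub_one_dvd_derivative_of_pow_dvd (hkG c)
    have hdeg := natDegree_le_of_dvd hdvd (mul_ne_zero hqj hG')
    rw [natDegree_prod_of_monic _ _ fun c _ => (monic_X_sub_C c).pow _] at hdeg
    simp only [natDegree_pow, natDegree_X_sub_C, mul_one] at hdeg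
    have h1 := natDegree_derivative_sum_le (fun i => q (j + i)) hm hN hqm
    have h2 := hqm 0 (Nat.zero_le _)
    have h3 : (q j * derivative G).natDegree ≤ m * (p - N) + (m * p - N - 1) :=
      natDegree_mul_le.trans (add_le_add (by simpa using h2) h1)
    have h4 : N + 1 ≤ m * p := by nlinarith
    obtain ⟨e, he⟩ := Nat.exists_eq_add_of_le h4
    rw [ht', show m * p - N - 1 = e by omega] at h3
    nlinarith

end PrimeField

section Redei

variable {p : ℕ} [Fact p.Prime] {ι : Type*}

/-- The Rédei polynomial of the points `(a u, b u)`, `u ∈ U`. -/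
noncomputable def redei (U : Finset ι) (a b : ι → ZMod p) : (ZMod p)[X][X] :=
  ∏ u ∈ U, (X + C (C (a u) * X - C (b u)))

/-- The number of points `(a u, b u)`, `u ∈ U`, on the line with slope `m` and intercept `c`. -/
noncomputable def lineCount (U : Finset ι) (a b : ι → ZMod p) (m c : ZMod p) : ℕ :=
  #{u ∈ U | b u - m * a u = c}

theorem sum_lineCount (U : Finset ι) (a b : ι → ZMod p) (m : ZMod p) :
    ∑ c, lineCount U a b m c = #U :=
  (card_eq_sum_card_fiberwise fun u _ => mem_coe.2 (mem_univ (b u - m * a u))).symm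

variable (p) in
/-- The polynomial `X ^ p - X` in factored form, seen as a bivariate polynomial. -/
noncomputable def vanishingPoly : (ZMod p)[X][X] := ∏ c : ZMod p, (X - C (C c))

theorem vanishingPoly_monic : (vanishingPoly p).Monic :=
  monic_prod_of_monic _ _ fun _ _ => monic_X_sub_C _

theorem natDegree_vanishingPoly : (vanishingPoly p).natDegree = p := by
  rw [vanishingPoly, natDegree_prod_of_monic _ _ fun _ _ => monic_X_sub_C _]
  simp [ZMod.card]

theorem totalDegLE_vanishingPoly : TotalDegLE p (vanishingPoly p) := by
  have := TotalDegLE.prod univ (fun c : ZMod p => (X - C (C c) : (ZMod p)[X][X])) fun c _ => by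
    simpa [sub_eq_add_neg] using TotalDegLE.X_add_C_linear 0 c
  rwa [card_univ, ZMod.card] at this

theorem map_vanishingPoly (y : ZMod p) :
    (vanishingPoly p).map (evalRingHom y) = ∏ c : ZMod p, (X - C c) := by
  simp [vanishingPoly, Polynomial.map_prod]

theorem redei_monic (U : Finset ι) (a b : ι → ZMod p) : (redei U a b).Monic :=
  monic_prod_of_monic _ _ fun _ _ => monic_X_add_C _

theorem natDegree_redei (U : Finset ι) (a b : ι → ZMod p) : (redei U a b).natDegree = #U := by
  rw [redei, natDegree_prod_of_monic _ _ fun _ _ => monic_X_add_C _]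
  simp only [natDegree_X_add_C, sum_const, smul_eq_mul, mul_one]

theorem totalDegLE_redei (U : Finset ι) (a b : ι → ZMod p) : TotalDegLE #U (redei U a b) :=
  TotalDegLE.prod _ _ fun _ _ => TotalDegLE.X_add_C_linear _ _

theorem map_redei (U : Finset ι) (a b : ι → ZMod p) (y : ZMod p) :
    (redei U a b).map (evalRingHom y) = ∏ c, (X - C c) ^ lineCount U a b y c := by
  rw [redei, Polynomial.map_prod, ← prod_fiberwise U fun u => b u - y * a u]
  refine prod_congr rfl fun c _ => ?_
  rw [lineCount, ← prod_const]
  refine prod_congr rfl fun u hu => ?_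
  rw [← (mem_filter.1 hu).2]
  simp
  ring

/-- All lines with slope `m` contain `n` or `n - 1` of the points. -/
def IsBalanced (U : Finset ι) (a b : ι → ZMod p) (n : ℕ) (m : ZMod p) : Prop :=
  ∀ c, lineCount U a b m c = n ∨ lineCount U a b m c + 1 = n

/-- The complementary factor of the Rédei polynomial in `(X ^ p - X) ^ n`. -/
noncomputable def coRedei (U : Finset ι) (a b : ι → ZMod p) (n : ℕ) : (ZMod p)[X][X] :=
  vanishingPoly p ^ n /ₘ redei U a b

variable {U : Finset ι} {a b : ι → ZMod p} {n r : ℕ} {m : ZMod p}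

theorem totalDegLE_coRedei (hU : #U + r = n * p) : TotalDegLE r (coRedei U a b n) := by
  refine TotalDegLE.divByMonic (redei_monic U a b) ?_ ?_
  · rw [natDegree_redei]
    exact totalDegLE_redei U a b
  · rw [natDegree_redei, hU]
    exact totalDegLE_vanishingPoly.pow n

theorem map_coRedei (hm : IsBalanced U a b n m) :
    (coRedei U a b n).map (evalRingHom m) = ∏ c, (X - C c) ^ (n - lineCount U a b m c) := by
  rw [coRedei, map_divByMonic _ (redei_monic U a b), Polynomial.map_pow, map_vanishingPoly]
  have h : (∏ c : ZMod p, (X - C c)) ^ n = (redei U a b).map (evalRingHom m) *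
      ∏ c, (X - C c) ^ (n - lineCount U a b m c) := by
    rw [map_redei, ← prod_mul_distrib, ← prod_pow]
    refine prod_congr rfl fun c _ => ?_
    rw [← pow_add]
    congr 1
    have := hm c
    omega
  rw [h, mul_divByMonic_cancel_left _ ((redei_monic U a b).map _)]

theorem eval_map_coRedei_eq_zero_iff (hm : IsBalanced U a b n m) (c : ZMod p) :
    ((coRedei U a b n).map (evalRingHom m)).eval c = 0 ↔ lineCount U a b m c + 1 = n := by
  rw [map_coRedei hm, eval_prod, prod_eq_zero_iff]
  constructor
  · rintro ⟨d, -, hd⟩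
    rw [eval_pow] at hd
    have hne : n - lineCount U a b m d ≠ 0 := by
      intro h
      rw [h, pow_zero] at hd
      exact one_ne_zero hd
    have hcd : c = d := by simpa [sub_eq_zero] using (pow_eq_zero_iff hne).1 hd
    have := hm c
    rw [← hcd] at hne
    omega
  · intro h
    refine ⟨c, mem_univ c, ?_⟩
    rw [show n - lineCount U a b m c = 1 by omega]
    simp

theorem eval_eval_eq_eval_map {R : Type*} [CommRing R] (P : R[X][X]) (q : R[X]) (y : R) :
    (P.eval q).eval y = (P.map (evalRingHom y)).eval (q.eval y) := by
  rw [← coe_evalRingHom, ← eval_map_apply, coe_evalRingHom]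

theorem lineCount_add_one_eq_of_lt_card (hU : #U + r = n * p) {M : Finset (ZMod p)}
    (hM : ∀ m ∈ M, IsBalanced U a b n m) (x y : ZMod p)
    (hr : r < #{m ∈ M | lineCount U a b m (y - m * x) + 1 = n}) (hmM : m ∈ M) :
    lineCount U a b m (y - m * x) + 1 = n := by
  have key : ∀ m, ((coRedei U a b n).eval (C y - C x * X)).eval m =
      ((coRedei U a b n).map (evalRingHom m)).eval (y - x * m) := fun m => by
    rw [eval_eval_eq_eval_map, eval_sub, eval_mul, eval_C, eval_C, eval_X]
  have hzero : (coRedei U a b n).eval (C y - C x * X) = 0 := by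
    refine eq_zero_of_natDegree_lt_card_of_eval_eq_zero' _
      {m ∈ M | lineCount U a b m (y - m * x) + 1 = n} (fun m hm => ?_) ?_
    · rw [mem_filter] at hm
      rw [key, mul_comm, eval_map_coRedei_eq_zero_iff (hM m hm.1)]
      exact hm.2
    · refine ((totalDegLE_coRedei hU).natDegree_eval_le ?_).trans_lt hr
      refine (natDegree_sub_le _ _).trans (max_le (by simp) ?_)
      exact (natDegree_C_mul_le _ _).trans natDegree_X_le
  rw [← eval_map_coRedei_eq_zero_iff (hM m hmM), mul_comm m, ← key, hzero, eval_zero]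

theorem mem_span_pow_of_forall {m : ZMod p} {H : (ZMod p)[X][X]}
    (hH : ∀ c : ZMod p, H ∈ Ideal.span {X - C (C c), C (X - C m)} ^ n) :
    H ∈ Ideal.span {vanishingPoly p, C (X - C m)} ^ n := by
  have hcop : ∀ c d : ZMod p, c ≠ d → IsCoprime
      (Ideal.span {X - C (C c), C (X - C m)} : Ideal (ZMod p)[X][X])
      (Ideal.span {X - C (C d), C (X - C m)}) := fun c d hcd => by
    rw [Ideal.isCoprime_iff_exists]
    have hne : d - c ≠ 0 := sub_ne_zero.2 hcd.symm
    refine ⟨C (C (d - c)⁻¹) * (X - C (C c)), Ideal.mul_mem_left _ _ (Ideal.subset_span (by simp)),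
      - C (C (d - c)⁻¹) * (X - C (C d)), Ideal.mul_mem_left _ _ (Ideal.subset_span (by simp)), ?_⟩
    rw [show C (C (d - c)⁻¹) * (X - C (C c)) + - C (C (d - c)⁻¹) * (X - C (C d)) =
      (C (C ((d - c)⁻¹ * (d - c))) : (ZMod p)[X][X]) by simp; ring, inv_mul_cancel₀ hne, C_1, C_1]
  have hprod : ∀ s : Finset (ZMod p),
      ∏ c ∈ s, (Ideal.span {X - C (C c), C (X - C m)} : Ideal (ZMod p)[X][X]) ≤
        Ideal.span {∏ c ∈ s, (X - C (C c)), C (X - C m)} := fun s => by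
    induction s using Finset.induction_on with
    | empty =>
      rw [prod_empty, prod_empty, (Ideal.eq_top_iff_one _).2 (Ideal.subset_span (by simp))]
      exact le_top
    | insert c s hc ih =>
      rw [prod_insert hc, prod_insert hc]
      refine (Ideal.mul_mono_right ih).trans ?_
      rw [Ideal.span_pair_mul_span_pair, Ideal.span_le]
      intro x hx
      rw [SetLike.mem_coe, Ideal.mem_span_pair]
      simp only [Set.mem_insert_iff, Set.mem_singleton_iff] at hx
      rcases hx with rfl | rfl | rfl | rfl
      · exact ⟨1, 0, by ring⟩
      · exact ⟨0, X - C (C c), by ring⟩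
      · exact ⟨0, ∏ c ∈ s, (X - C (C c)), by ring⟩
      · exact ⟨0, C (X - C m), by ring⟩
  have hmem : H ∈ ⨅ c ∈ (univ : Finset (ZMod p)),
      (Ideal.span {X - C (C c), C (X - C m)} : Ideal (ZMod p)[X][X]) ^ n := by
    simpa [Submodule.mem_iInf] using hH
  rw [← Ideal.prod_eq_iInf_of_pairwise_isCoprime fun c _ d _ hcd => (hcop c d hcd).pow,
    prod_pow] at hmem
  exact Ideal.pow_right_mono (hprod univ) n hmem

theorem mul_mem_pow_succ {R : Type*} [CommRing R] {I : Ideal R} {k : ℕ} {x y : R}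
    (hx : x ∈ I ^ k) (hy : y ∈ I) : x * y ∈ I ^ (k + 1) := by
  rw [pow_succ]
  exact Ideal.mul_mem_mul hx hy

theorem redei_mul_coRedei_mem (hm : IsBalanced U a b n m) :
    redei U a b * coRedei U a b n ∈ Ideal.span {vanishingPoly p, C (X - C m)} ^ n := by
  refine mem_span_pow_of_forall fun c => ?_
  set I : Ideal (ZMod p)[X][X] := Ideal.span {X - C (C c), C (X - C m)} with hI
  have h1 : redei U a b ∈ I ^ lineCount U a b m c := by
    rw [redei, ← prod_filter_mul_prod_filter_not U fun u => b u - m * a u = c]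
    refine Ideal.mul_mem_right _ _ ?_
    rw [lineCount, ← prod_const I]
    refine Ideal.prod_mem_prod fun u hu => ?_
    rw [hI, Ideal.mem_span_pair]
    refine ⟨1, C (C (a u)), ?_⟩
    rw [← (mem_filter.1 hu).2]
    simp
    ring
  rcases hm c with hc | hc
  · rw [hc] at h1
    exact Ideal.mul_mem_right _ _ h1
  · suffices coRedei U a b n ∈ I by
      have h := mul_mem_pow_succ h1 this
      rwa [hc] at h
    have h0 := (eval_map_coRedei_eq_zero_iff hm c).2 hc
    set f := coRedei U a b n with hf
    have h2 : X - C (C c) ∣ f - C (f.eval (C c)) := X_sub_C_dvd_sub_C_eval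
    have h3 : X - C m ∣ f.eval (C c) := by
      rw [dvd_iff_isRoot, IsRoot.def, eval_eval_eq_eval_map, eval_C, h0]
    obtain ⟨g, hg⟩ := h2
    obtain ⟨g', hg'⟩ := h3
    rw [hI, Ideal.mem_span_pair]
    refine ⟨g, C g', ?_⟩
    have : f = (X - C (C c)) * g + C ((X - C m) * g') := by rw [← hg, ← hg']; ring
    rw [this, C_mul]
    ring

theorem natDegree_map_adicDigit_le {H : (ZMod p)[X][X]} (hH : TotalDegLE (n * p) H)
    {M : Finset (ZMod p)}
    (hM : ∀ m ∈ M, H ∈ Ideal.span {vanishingPoly p, C (X - C m)} ^ n) {l : ℕ} (hl : l < n)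
    (y : ZMod p) :
    ((adicDigit (vanishingPoly p) l H).map (evalRingHom y)).natDegree ≤ (n - l) * (p - #M) := by
  have hcard : #M ≤ p := by
    have := card_le_univ M
    rwa [ZMod.card] at this
  have hdeg : TotalDegLE ((n - l) * p) (adicDigit (vanishingPoly p) l H) := by
    have hW := totalDegLE_vanishingPoly (p := p)
    have h := TotalDegLE.adicDigit (W := vanishingPoly p) (n := n) (l := l) (P := H)
      vanishingPoly_monic
    rw [natDegree_vanishingPoly] at h
    exact h hW hl hH
  refine natDegree_le_iff_coeff_eq_zero.2 fun t ht => ?_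
  rw [coeff_map]
  suffices (adicDigit (vanishingPoly p) l H).coeff t = 0 by rw [this, map_zero]
  have hdvd : (∏ m ∈ M, (X - C m)) ^ (n - l) ∣ (adicDigit (vanishingPoly p) l H).coeff t := by
    rw [← prod_pow]
    refine Finset.prod_dvd_of_coprime (fun c _ d _ hcd => ?_) fun m hm => ?_
    · exact (pairwise_coprime_X_sub_C Function.injective_id hcd).pow
    · exact (C_dvd_iff_dvd_coeff _ _).1 (pow_dvd_adicDigit vanishingPoly_monic _ n (hM m hm) l) t
  by_contra hne
  have h1 := natDegree_le_of_dvd hdvd hne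
  rw [natDegree_pow, natDegree_prod_of_monic _ _ fun _ _ => monic_X_sub_C _] at h1
  simp only [natDegree_X_sub_C, sum_const, smul_eq_mul, mul_one] at h1
  have h2 : (n - l) * p < t + (n - l) * #M := by
    calc (n - l) * p = (n - l) * (p - #M) + (n - l) * #M := by
          rw [← mul_add, Nat.sub_add_cancel hcard]
      _ < _ := by omega
  have h3 : ((adicDigit (vanishingPoly p) l H).coeff t).natDegree < (n - l) * #M := by
    refine (natDegree_lt_iff_degree_lt hne).2 ((degree_lt_iff_coeff_zero _ _).2 fun s hs => ?_)
    exact hdeg t s (by omega)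
  omega

theorem exists_large_lineCount (hU : #U + r = n * p) {M : Finset (ZMod p)}
    (hM : ∀ m ∈ M, IsBalanced U a b n m) (hMp : #M < p) (hr : n * p + r ≤ (n + 1) * #M)
    {y : ZMod p} (hy : ∃ c, n < lineCount U a b y c) :
    ∃ c, n * (p - #M) < lineCount U a b y c := by
  set H := redei U a b * coRedei U a b n with hHdef
  have hHd : TotalDegLE (n * p) H := hU ▸ (totalDegLE_redei U a b).mul (totalDegLE_coRedei hU)
  have hHM : ∀ m ∈ M, H ∈ Ideal.span {vanishingPoly p, C (X - C m)} ^ n :=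
    fun m hm => redei_mul_coRedei_mem (hM m hm)
  have htop : TotalDegLE 0 ((· /ₘ vanishingPoly p)^[n] H) := by
    have h := TotalDegLE.iterate_divByMonic (W := vanishingPoly p) vanishingPoly_monic
      (n := n) (l := n) (P := H)
    rw [natDegree_vanishingPoly, Nat.sub_self, zero_mul] at h
    exact h totalDegLE_vanishingPoly le_rfl hHd
  have hmapW : (vanishingPoly p).map (evalRingHom y) = X ^ p - X := by
    rw [map_vanishingPoly, prod_X_sub_C_zmod]
  refine exists_large_multiplicity (lineCount U a b y) (H := H.map (evalRingHom y))
    (fun l => if l < n then (adicDigit (vanishingPoly p) l H).map (evalRingHom y)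
      else ((· /ₘ vanishingPoly p)^[n] H).map (evalRingHom y)) ?_ ?_ (fun l hl => ?_) ?_
    (fun c => ?_) hy hMp hr
  · have hco : (coRedei U a b n).Monic := by
      rw [coRedei, Monic, leadingCoeff_divByMonic_of_monic (redei_monic U a b) ?_]
      · exact vanishingPoly_monic.pow n
      · rw [degree_eq_natDegree (redei_monic U a b).ne_zero,
          degree_eq_natDegree (vanishingPoly_monic.pow n).ne_zero, natDegree_redei,
          vanishingPoly_monic.natDegree_pow, natDegree_vanishingPoly]
        exact_mod_cast (by omega : #U ≤ n * p)
    exact (((redei_monic U a b).mul hco).map _).ne_zero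
  · conv_lhs => rw [eq_sum_adicDigit (vanishingPoly p) H n]
    rw [Polynomial.map_add, Polynomial.map_sum, sum_range_succ, if_neg (lt_irrefl n),
      Polynomial.map_mul, Polynomial.map_pow, hmapW]
    congr 1
    refine sum_congr rfl fun l hl => ?_
    rw [if_pos (mem_range.1 hl), Polynomial.map_mul, Polynomial.map_pow, hmapW]
  · split_ifs with h
    · exact natDegree_map_adicDigit_le hHd hHM h y
    · refine natDegree_le_iff_coeff_eq_zero.2 fun t ht => ?_
      rw [coeff_map]
      suffices (((· /ₘ vanishingPoly p)^[n] H).coeff t) = 0 by rw [this, map_zero]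
      exact Polynomial.ext fun s => htop t s (by omega)
  · rw [sum_lineCount, hU]
  · rw [hHdef, Polynomial.map_mul, map_redei]
    exact (dvd_prod_of_mem _ (mem_univ c)).mul_right _

end Redei

section Directions

variable {p : ℕ} [Fact p.Prime]

/-- The intercept of the line with slope `m` through the point `u`. -/
def intercept (m : Option (ZMod p)) (u : ZMod p × ZMod p) : ZMod p :=
  match m with
  | some m => u.2 - m * u.1
  | none => u.1

theorem mem_lineWithSlope_iff (m : Option (ZMod p)) (c : ZMod p) (u : ZMod p × ZMod p) :
    u ∈ lineWithSlope p m c ↔ intercept m u = c := by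
  cases m with
  | none => simp [lineWithSlope, intercept]
  | some m => simp [lineWithSlope, intercept, sub_eq_iff_eq_add']

theorem existsUnique_intercept_eq {m m' : Option (ZMod p)} (h : m ≠ m') (c c' : ZMod p) :
    ∃! u, intercept m u = c ∧ intercept m' u = c' := by
  cases m with
  | none =>
    cases m' with
    | none => exact absurd rfl h
    | some m' =>
      refine ⟨(c, c' + m' * c), by simp [intercept], ?_⟩
      rintro ⟨x, y⟩ ⟨h1, h2⟩
      simp only [intercept] at h1 h2
      subst h1 h2
      simp
  | some m =>
    cases m' with
    | none =>
      refine ⟨(c', c + m * c'), by simp [intercept], ?_⟩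
      rintro ⟨x, y⟩ ⟨h1, h2⟩
      simp only [intercept] at h1 h2
      subst h1 h2
      simp
    | some m' =>
      have hne : m' - m ≠ 0 := sub_ne_zero.2 fun h' => h (by rw [h'])
      refine ⟨((c - c') / (m' - m), c + m * ((c - c') / (m' - m))), ⟨by simp [intercept], ?_⟩, ?_⟩
      · simp only [intercept]
        field_simp
        ring
      · rintro ⟨x, y⟩ ⟨h1, h2⟩
        simp only [intercept] at h1 h2
        have hx : x = (c - c') / (m' - m) := by
          rw [eq_div_iff hne, ← h1, ← h2]
          ring
        rw [Prod.mk.injEq, ← hx, ← h1]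
        exact ⟨rfl, by ring⟩

theorem exists_intercept_eq (u v : ZMod p × ZMod p) : ∃ m, intercept m u = intercept m v := by
  by_cases h : u.1 = v.1
  · exact ⟨none, h⟩
  · have hne : u.1 - v.1 ≠ 0 := sub_ne_zero.2 h
    refine ⟨some ((u.2 - v.2) / (u.1 - v.1)), ?_⟩
    simp only [intercept]
    field_simp
    ring

/-- Affine coordinates in which lines with slope `z` become vertical. -/
theorem exists_coordinates (z : Option (ZMod p)) :
    ∃ (a b : ZMod p × ZMod p → ZMod p) (ρ : ZMod p → Option (ZMod p))
      (τ : ZMod p → ZMod p → ZMod p), Function.Injective ρ ∧ (∀ m, m ≠ z → ∃ μ, ρ μ = m) ∧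
      (∀ μ, Function.Bijective (τ μ)) ∧
      ∀ μ u, intercept (ρ μ) u = τ μ (b u - μ * a u) := by
  cases z with
  | none =>
    refine ⟨Prod.fst, Prod.snd, some, fun _ => id, Option.some_injective _, fun m hm => ?_,
      fun _ => Function.bijective_id, fun _ _ => rfl⟩
    exact ⟨m.get (Option.isSome_iff_ne_none.2 hm), by simp⟩
  | some z =>
    refine ⟨fun u => u.2 - z * u.1, Prod.fst, fun μ => if μ = 0 then none else some (z + μ⁻¹),
      fun μ c => if μ = 0 then c else - μ⁻¹ * c, fun μ ν h => ?_, fun m hm => ?_, fun μ => ?_,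
      fun μ u => ?_⟩
    · by_cases hμ : μ = 0 <;> by_cases hν : ν = 0 <;> simp_all
    · cases m with
      | none => exact ⟨0, by simp⟩
      | some m =>
        have hne : m - z ≠ 0 := sub_ne_zero.2 fun h => hm (by rw [h])
        exact ⟨(m - z)⁻¹, by simp [hne]⟩
    · by_cases hμ : μ = 0
      · simp only [hμ, if_true]
        exact Function.bijective_id
      · simp only [hμ, if_false]
        exact mulLeft_bijective₀ _ (neg_ne_zero.2 (inv_ne_zero hμ))
    · by_cases hμ : μ = 0
      · simp [hμ, intercept]
      · simp only [hμ, if_false, intercept]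
        field_simp
        ring

/-- The number of points of `U` on the line with slope `m` and intercept `c`. -/
noncomputable def directionCount (U : Finset (ZMod p × ZMod p)) (m : Option (ZMod p))
    (c : ZMod p) : ℕ :=
  #{u ∈ U | intercept m u = c}

theorem card_lineWithSlope_inter (U : Finset (ZMod p × ZMod p)) (m : Option (ZMod p))
    (c : ZMod p) : #(lineWithSlope p m c ∩ U) = directionCount U m c := by
  rw [directionCount]
  congr 1
  ext u
  rw [mem_inter, mem_lineWithSlope_iff, mem_filter, and_comm]

theorem sum_directionCount (U : Finset (ZMod p × ZMod p)) (m : Option (ZMod p)) :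
    ∑ c, directionCount U m c = #U :=
  (card_eq_sum_card_fiberwise fun u _ => mem_coe.2 (mem_univ (intercept m u))).symm

theorem lineCount_eq_directionCount {a b : ZMod p × ZMod p → ZMod p} {m : Option (ZMod p)}
    {μ : ZMod p} {τ : ZMod p → ZMod p} (hτ : Function.Injective τ)
    (h : ∀ u, intercept m u = τ (b u - μ * a u)) (U : Finset (ZMod p × ZMod p)) (c : ZMod p) :
    lineCount U a b μ c = directionCount U m (τ c) := by
  rw [lineCount, directionCount]
  congr 1
  ext u
  simp only [mem_filter, h, hτ.eq_iff]

variable {M : Finset (Option (ZMod p))} {U : Finset (ZMod p × ZMod p)} {n r : ℕ}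

theorem card_filter_mem_eq {α β : Type*} [Fintype α] {ρ : α → β} (hρ : Function.Injective ρ)
    {S : Finset β} (hS : ∀ m ∈ S, ∃ μ, ρ μ = m) [DecidablePred fun μ => ρ μ ∈ S] :
    #{μ | ρ μ ∈ S} = #S := by
  refine card_bij (fun μ _ => ρ μ) (fun μ hμ => (mem_filter.1 hμ).2) (fun _ _ _ _ h => hρ h)
    fun m hm => ?_
  obtain ⟨μ, rfl⟩ := hS m hm
  exact ⟨μ, by simpa using hm, rfl⟩

theorem exists_rich_of_card_lt (hU : #U + r = n * p) (hn : 1 ≤ n) (hr : r < p)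
    (hM : #M < p) (hMr : n * p + r ≤ (n + 1) * #M) : ∃ m c, n < directionCount U m c := by
  by_contra! hcon
  have hpos : 0 < #U := by nlinarith
  obtain ⟨u, hu⟩ := card_pos.1 hpos
  have h1 : #(U.erase u) ≤ #(univ : Finset (Option (ZMod p))) * (n - 1) := by
    refine (card_le_card (t := univ.biUnion fun m =>
      ({v ∈ U | intercept m v = intercept m u}).erase u) fun v hv => ?_).trans
        (card_biUnion_le_card_mul _ _ _ fun m _ => ?_)
    · obtain ⟨m, hm⟩ := exists_intercept_eq v u
      rw [mem_erase] at hv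
      simp only [mem_biUnion, mem_univ, true_and, mem_erase, mem_filter]
      exact ⟨m, hv.1, hv.2, hm⟩
    · rw [card_erase_of_mem (by simp [hu])]
      exact Nat.sub_le_sub_right (hcon m (intercept m u)) 1
  rw [card_erase_of_mem hu, card_univ, Fintype.card_option, ZMod.card] at h1
  obtain ⟨k, rfl⟩ : ∃ k, n = k + 1 := ⟨n - 1, by omega⟩
  rw [Nat.add_sub_cancel] at h1
  have h2 : #U ≤ (p + 1) * k + 1 := by omega
  have h3 : #M + 1 ≤ p := hM
  nlinarith

theorem exists_large_directionCount (hU : #U + r = n * p) (hn : 1 ≤ n) (hr : r < p)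
    (hMp : #M ≤ p) (hMr : n * p + r ≤ (n + 1) * #M)
    (hM : ∀ m ∈ M, ∀ c, directionCount U m c = n ∨ directionCount U m c + 1 = n) :
    ∃ m ∉ M, ∃ c, n * (p - #M) < directionCount U m c := by
  have hexists : ∀ S : Finset (Option (ZMod p)), #S ≤ p → ∃ z, z ∉ S := fun S hS => by
    by_contra! hall
    have h1 : #S = Fintype.card (Option (ZMod p)) := by rw [(eq_univ_iff_forall.2 hall), card_univ]
    rw [Fintype.card_option, ZMod.card] at h1
    omega
  rcases hMp.eq_or_lt with hMp | hMp
  · obtain ⟨z, hz⟩ := hexists M hMp.le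
    have hpos : 0 < #U := by nlinarith
    obtain ⟨u, hu⟩ := card_pos.1 hpos
    refine ⟨z, hz, intercept z u, ?_⟩
    rw [hMp, Nat.sub_self, mul_zero]
    exact card_pos.2 ⟨u, by simp [hu]⟩
  · obtain ⟨y, c, hyc⟩ := exists_rich_of_card_lt hU hn hr hMp hMr
    have hyM : y ∉ M := fun hy => by
      have := hM y hy c
      omega
    obtain ⟨z, hz⟩ := hexists (insert y M) (by rw [card_insert_of_notMem hyM]; omega)
    rw [mem_insert, not_or] at hz
    obtain ⟨a, b, ρ, τ, hρ, hρz, hτ, hρτ⟩ := exists_coordinates z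
    obtain ⟨μ, rfl⟩ := hρz y fun h => hz.1 h.symm
    have hcount := fun ν => lineCount_eq_directionCount (hτ ν).injective (hρτ ν) U
    have hcard : #{ν | ρ ν ∈ M} = #M :=
      card_filter_mem_eq hρ fun m hm => hρz m fun h => hz.2 (h ▸ hm)
    obtain ⟨d, hd⟩ := exists_large_lineCount (U := U) (a := a) (b := b) (n := n) (r := r)
      (M := {ν | ρ ν ∈ M}) (y := μ) hU
      (fun ν hν d => by
        rw [hcount]
        exact hM _ (mem_filter.1 hν).2 _) (by rwa [hcard]) (by rwa [hcard]) (by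
        obtain ⟨d, rfl⟩ := (hτ μ).surjective c
        exact ⟨d, by rwa [hcount]⟩)
    rw [hcard, hcount] at hd
    exact ⟨ρ μ, hyM, _, hd⟩

theorem directionCount_add_one_eq (hU : #U + r = n * p)
    (hMp : #M ≤ p)
    (hM : ∀ m ∈ M, ∀ c, directionCount U m c = n ∨ directionCount U m c + 1 = n)
    {z : Option (ZMod p)} (hz : z ∉ M) {P : ZMod p × ZMod p} (hP : P ∉ U)
    (hlarge : n * (p - #M) < directionCount U z (intercept z P)) {m : Option (ZMod p)}
    (hm : m ∈ M) : directionCount U m (intercept m P) + 1 = n := by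
  set T := {m ∈ M | directionCount U m (intercept m P) + 1 = n} with hT
  have hsum1 : ∑ m ∈ insert z M, directionCount U m (intercept m P) ≤ #U := by
    simp only [directionCount]
    rw [← card_biUnion]
    · exact card_le_card (biUnion_subset.2 fun m _ => filter_subset _ _)
    · intro m _ m' _ hmm'
      rw [Function.onFun, Finset.disjoint_left]
      intro u hu hu'
      rw [mem_filter] at hu hu'
      exact hP ((existsUnique_intercept_eq hmm' (intercept m P) (intercept m' P)).unique
        ⟨hu.2, hu'.2⟩ ⟨rfl, rfl⟩ ▸ hu.1)
  have hsum2 : ∑ m ∈ M, directionCount U m (intercept m P) + #T = #M * n := by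
    rw [hT, card_filter, ← sum_add_distrib, ← smul_eq_mul, ← sum_const]
    refine sum_congr rfl fun m hm => ?_
    have := hM m hm (intercept m P)
    split_ifs <;> omega
  have hrT : r < #T := by
    rw [sum_insert hz] at hsum1
    obtain ⟨t, ht⟩ := Nat.exists_eq_add_of_le hMp
    rw [show p - #M = t by omega] at hlarge
    have : n * p = n * #M + n * t := by rw [← mul_add]; exact congrArg (n * ·) ht
    nlinarith
  obtain ⟨a, b, ρ, τ, hρ, hρz, hτ, hρτ⟩ := exists_coordinates z
  have hcount := fun ν => lineCount_eq_directionCount (hτ ν).injective (hρτ ν) U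
  obtain ⟨μ, rfl⟩ := hρz m fun h => hz (h ▸ hm)
  have hcard : #{ν | ρ ν ∈ T} = #T :=
    card_filter_mem_eq hρ (S := T) fun m hm => hρz m fun h => hz (h ▸ (mem_filter.1 hm).1)
  have key := lineCount_add_one_eq_of_lt_card (U := U) (a := a) (b := b) (n := n) (r := r)
    (M := {ν | ρ ν ∈ M}) (m := μ) hU
    (fun ν hν d => by
      rw [hcount]
      exact hM _ (mem_filter.1 hν).2 _) (a P) (b P) (by
      refine hrT.trans_le (hcard.symm.le.trans (card_le_card fun ν hν => ?_))
      simp only [hT, mem_filter, mem_univ, true_and] at hν ⊢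
      rwa [hcount, ← hρτ]) (by simpa using hm)
  rwa [hcount, ← hρτ] at key

theorem directionCount_insert {P : ZMod p × ZMod p} (hP : P ∉ U) (m : Option (ZMod p))
    (c : ZMod p) : directionCount (insert P U) m c =
      directionCount U m c + if intercept m P = c then 1 else 0 := by
  rw [directionCount, directionCount, filter_insert]
  split_ifs with h
  · rw [card_insert_of_notMem fun h => hP (mem_filter.1 h).1]
  · rfl

theorem directionCount_filter_add_one {z m : Option (ZMod p)} (hmz : m ≠ z) {c : ZMod p}
    (hU : ∀ u, intercept z u = c → u ∈ U) (d : ZMod p) :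
    directionCount {u ∈ U | intercept z u ≠ c} m d + 1 = directionCount U m d := by
  obtain ⟨P, ⟨hPm, hPz⟩, hPu⟩ := existsUnique_intercept_eq hmz d c
  have hmem : P ∈ {u ∈ U | intercept m u = d} := by simp [hU P hPz, hPm]
  rw [directionCount, directionCount, ← card_erase_add_one hmem]
  congr 2
  ext u
  simp only [mem_filter, mem_erase]
  constructor
  · rintro ⟨⟨h1, h2⟩, h3⟩
    exact ⟨fun h => h2 (h ▸ hPz), h1, h3⟩
  · rintro ⟨h1, h2, h3⟩
    exact ⟨⟨h2, fun h => h1 (hPu u ⟨h3, h⟩)⟩, h3⟩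

theorem exists_cover (hMp : #M ≤ p) (n r : ℕ) (U : Finset (ZMod p × ZMod p)) (hr : r < p)
    (hU : #U + r = n * p) (hMr : n * p + r ≤ (n + 1) * #M)
    (hM : ∀ m ∈ M, ∀ c, directionCount U m c = n ∨ directionCount U m c + 1 = n) :
    ∃ L : Fin n → Option (ZMod p) × ZMod p,
      ∀ u ∈ U, ∃ i : Fin n, intercept (L i).1 u = (L i).2 := by
  induction n generalizing r U with
  | zero =>
    have : U = ∅ := card_eq_zero.1 (by omega)
    exact ⟨Fin.elim0, by simp [this]⟩
  | succ n ihn =>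
    induction r using Nat.strong_induction_on generalizing U with
    | _ r ihr =>
      obtain ⟨z, hz, c, hc⟩ := exists_large_directionCount hU (by omega) hr hMp hMr hM
      have hM0 : M.Nonempty := by
        rw [← card_pos]
        have hp : 0 < p := (Fact.out : p.Prime).pos
        by_contra! h
        rw [Nat.le_zero.1 h] at hMr
        nlinarith
      obtain ⟨m₀, hm₀⟩ := hM0
      by_cases hfull : ∀ u, intercept z u = c → u ∈ U
      · have hdec : ∀ m ∈ M, ∀ d, directionCount {u ∈ U | intercept z u ≠ c} m d + 1 =
            directionCount U m d := fun m hm d =>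
          directionCount_filter_add_one (fun h : m = z => hz (h ▸ hm)) hfull d
        have hcard : #{u ∈ U | intercept z u ≠ c} + p = #U := by
          rw [← sum_directionCount U m₀, ← sum_directionCount _ m₀,
            ← sum_congr rfl fun d _ => hdec m₀ hm₀ d, sum_add_distrib]
          simp [ZMod.card]
        obtain ⟨L, hL⟩ := ihn r {u ∈ U | intercept z u ≠ c} hr (by
          rw [add_mul] at hU
          omega) (by nlinarith) fun m hm d => by
            have h1 := hM m hm d
            have h2 := hdec m hm d
            omega
        refine ⟨Fin.cons (z, c) L, fun u hu => ?_⟩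
        by_cases huc : intercept z u = c
        · exact ⟨0, by simpa using huc⟩
        · obtain ⟨i, hi⟩ := hL u (mem_filter.2 ⟨hu, huc⟩)
          exact ⟨i.succ, by simpa using hi⟩
      · push Not at hfull
        obtain ⟨P, rfl, hP⟩ := hfull
        have hadd := fun m hm => directionCount_add_one_eq hU hMp hM hz hP hc (m := m) hm
        have hr0 : 0 < r := by
          have hlt : ∑ d, directionCount U m₀ d < ∑ _d : ZMod p, (n + 1) := by
            refine sum_lt_sum (fun d _ => ?_) ⟨intercept m₀ P, mem_univ _, ?_⟩
            · have := hM m₀ hm₀ d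
              omega
            · have := hadd m₀ hm₀
              omega
          rw [sum_directionCount, sum_const, card_univ, ZMod.card, smul_eq_mul] at hlt
          nlinarith
        obtain ⟨L, hL⟩ := ihr (r - 1) (by omega) (insert P U) (by omega)
          (by rw [card_insert_of_notMem hP]; omega) (by omega) fun m hm d => by
            rw [directionCount_insert hP]
            split_ifs with h
            · exact Or.inl (h ▸ hadd m hm)
            · exact hM m hm d
        exact ⟨L, fun u hu => hL u (mem_insert_of_mem hu)⟩

theorem directionCount_of_not_isSpecialDir (hU : #U + r = n * p) (hr : r < p)
    {m : Option (ZMod p)} (hm : ¬ IsSpecialDir p U m) (c : ZMod p) :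
    directionCount U m c = n ∨ directionCount U m c + 1 = n := by
  simp only [IsSpecialDir, IsRich, IsPoor, card_lineWithSlope_inter, not_exists, not_or,
    not_le] at hm
  obtain ⟨h1, h2⟩ := hm c
  have hp : (0 : ℚ) < p := by exact_mod_cast (Fact.out : p.Prime).pos
  have hU' : (#U : ℚ) = n * p - r := by
    rw [eq_sub_iff_add_eq]
    exact_mod_cast hU
  have hrp : (r : ℚ) / p < 1 := by
    rw [div_lt_one hp]
    exact_mod_cast hr
  have hr0 : 0 ≤ (r : ℚ) / p := by positivity
  have hθ : (#U : ℚ) / p = n - r / p := by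
    rw [hU']
    field_simp
  rw [hθ] at h1 h2
  have h3 : directionCount U m c < n + 1 := by
    have : (directionCount U m c : ℚ) < n + 1 := by linarith
    exact_mod_cast this
  have h4 : n < directionCount U m c + 2 := by
    have : (n : ℚ) < directionCount U m c + 2 := by linarith
    exact_mod_cast this
  omega

end Directions

theorem rich_poor_directions (p n r : ℕ) [Fact p.Prime]
    (U : Finset (ZMod p × ZMod p))
    (hn : 1 ≤ n) (hnp : n ≤ p) (hr : r < p)
    (hcard : (U.card : ℤ) = n * p - r)
    (hlines : ¬ ∃ L : Fin n → Option (ZMod p) × ZMod p,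
      ∀ u ∈ U, ∃ i : Fin n, u ∈ lineWithSlope p (L i).1 (L i).2) :
    ⌈((p : ℚ) + n + 2 - r) / (n + 1)⌉
      ≤ ({m : Option (ZMod p) | IsSpecialDir p U m}.ncard : ℤ) := by
  have hU : #U + r = n * p := by
    have : ((#U + r : ℕ) : ℤ) = ((n * p : ℕ) : ℤ) := by
      push_cast
      linarith
    exact_mod_cast this
  by_contra! hlt
  rw [Int.lt_ceil, lt_div_iff₀ (by positivity)] at hlt
  set S : Finset (Option (ZMod p)) := {m | IsSpecialDir p U m} with hS
  have hScard : {m : Option (ZMod p) | IsSpecialDir p U m}.ncard = #S := by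
    rw [← Set.ncard_coe_finset]
    congr 1
    ext m
    simp [hS]
  rw [hScard] at hlt
  have hlt' : #S * (n + 1) + r < p + n + 2 := by
    have : ((#S * (n + 1) + r : ℕ) : ℚ) < ((p + n + 2 : ℕ) : ℚ) := by
      push_cast at hlt ⊢
      linarith
    exact_mod_cast this
  have hcompl : #S + #Sᶜ = p + 1 := by
    rw [card_add_card_compl, Fintype.card_option, ZMod.card]
  obtain ⟨M, hMS, hMcard⟩ := exists_subset_card_eq (min_le_left #Sᶜ p)
  have hMp : #M ≤ p := hMcard ▸ min_le_right _ _
  have hMr : n * p + r ≤ (n + 1) * #M := by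
    rcases le_total #Sᶜ p with h | h
    · rw [min_eq_left h] at hMcard
      rw [hMcard]
      nlinarith
    · rw [min_eq_right h] at hMcard
      rw [hMcard]
      nlinarith
  obtain ⟨L, hL⟩ := exists_cover hMp n r U hr hU hMr fun m hm c =>
    directionCount_of_not_isSpecialDir hU hr (by simpa [hS] using hMS hm) c
  refine hlines ⟨L, fun u hu => ?_⟩
  obtain ⟨i, hi⟩ := hL u hu
  exact ⟨i, (mem_lineWithSlope_iff _ _ _).2 hi⟩
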